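/- For every ε > 0 there exists N such that for all integers n ≥ N, the number of positive integers m with φ(m) = n satisfies N_φ^1(n) ≤ n / L(n)^{1−ε}. -/

import Mathlib

/-- `L n = exp(log n · log log log n / log log n)` -/
noncomputable def L (n : ℝ) : ℝ :=
  Real.exp (Real.log n * Real.log (Real.log (Real.log n)) / Real.log (Real.log n))

open Finset in
lemma aux_lt_one (p : ℕ) (hp : 2 ≤ p) (c : ℝ) (hc : 1/2 ≤ c) : (p:ℝ)^(-c) ≤ 3/4 := by
  have h2 : (2:ℝ) ≤ p := by exact_mod_cast hp
  have h1 : (p:ℝ)^(-c) ≤ (2:ℝ)^(-c) :=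
    Real.rpow_le_rpow_of_nonpos (by norm_num) h2 (by linarith)
  have h3 : (2:ℝ)^(-c) ≤ (2:ℝ)^(-(1/2):ℝ) :=
    Real.rpow_le_rpow_of_exponent_le (by norm_num) (by linarith)
  have h4 : (2:ℝ)^(-(1/2):ℝ) ≤ 3/4 := by
    rw [Real.rpow_neg (by norm_num), ← Real.sqrt_eq_rpow]
    have : (4/3:ℝ) ≤ √2 := Real.le_sqrt_of_sq_le (by norm_num)
    calc (√2)⁻¹ ≤ (4/3:ℝ)⁻¹ := by gcongr
      _ = 3/4 := by norm_num
  linarith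

/-- Prime reciprocal sums over dyadic ranges. -/
lemma sum_inv_primes_dyadic (K : ℕ) :
    ∑ p ∈ (Finset.Icc 1 (2^(K+1))).filter Nat.Prime, (1:ℝ)/p ≤ 1 + 4 * (harmonic K : ℝ) := by
  induction K with
  | zero =>
    have : (Finset.Icc 1 (2^(0+1))).filter Nat.Prime = {2} := by decide
    rw [this]; norm_num
  | succ K ih =>
    have hsplit : (Finset.Icc 1 (2^(K+1+1))).filter Nat.Prime =
        (Finset.Icc 1 (2^(K+1))).filter Nat.Prime ∪
          (Finset.Ioc (2^(K+1)) (2^(K+1+1))).filter Nat.Prime := by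
      ext p
      have : 2^(K+1) ≤ 2^(K+1+1) := Nat.pow_le_pow_right (by norm_num) (by omega)
      have h1 : 1 ≤ 2^(K+1) := Nat.one_le_two_pow
      simp only [Finset.mem_filter, Finset.mem_union, Finset.mem_Icc, Finset.mem_Ioc]
      grind
    have hdisj : Disjoint ((Finset.Icc 1 (2^(K+1))).filter Nat.Prime)
        ((Finset.Ioc (2^(K+1)) (2^(K+1+1))).filter Nat.Prime) := by
      rw [Finset.disjoint_left]
      intro p
      simp only [Finset.mem_filter, Finset.mem_Icc, Finset.mem_Ioc]
      omega
    rw [hsplit, Finset.sum_union hdisj, harmonic_succ]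
    have hlog2 : 0 < Real.log 2 := Real.log_pos (by norm_num)
    have hpow : (0:ℝ) < 2^(K+1) := by positivity
    have hL : 0 < ((K:ℝ)+1) * Real.log 2 := by positivity
    have hkey : ∑ p ∈ (Finset.Ioc (2^(K+1)) (2^(K+1+1))).filter Nat.Prime, (1:ℝ)/p ≤
        4 * ((K:ℝ)+1)⁻¹ := by
      have hterm : ∀ p ∈ (Finset.Ioc (2^(K+1)) (2^(K+1+1))).filter Nat.Prime,
          (1:ℝ)/p ≤ Real.log p * (1 / (2^(K+1) * (((K:ℝ)+1) * Real.log 2))) := by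
        intro p hp
        simp only [Finset.mem_filter, Finset.mem_Ioc] at hp
        have hp1 : (2:ℝ)^(K+1) ≤ p := by exact_mod_cast hp.1.1.le
        have hp0 : (0:ℝ) < p := lt_of_lt_of_le hpow hp1
        have hlog : ((K:ℝ)+1) * Real.log 2 ≤ Real.log p := by
          have := Real.log_le_log hpow hp1
          rw [Real.log_pow] at this
          push_cast at this; exact this
        rw [mul_one_div, div_le_div_iff₀ hp0 (by positivity), one_mul, mul_comm (Real.log p)]
        gcongr
      have htheta : ∑ p ∈ (Finset.Ioc (2^(K+1)) (2^(K+1+1))).filter Nat.Prime, Real.log p ≤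
          Real.log 4 * 2^(K+1+1) := by
        have h := Chebyshev.theta_le_log4_mul_x (x := ((2^(K+1+1) : ℕ):ℝ)) (by positivity)
        rw [Chebyshev.theta_eq_sum_Icc, Nat.floor_natCast] at h
        push_cast at h
        refine le_trans (Finset.sum_le_sum_of_subset_of_nonneg ?_ ?_) h
        · intro p
          simp only [Finset.mem_filter, Finset.mem_Icc, Finset.mem_Ioc]
          grind
        · intro p _ _
          exact Real.log_natCast_nonneg p
      refine (Finset.sum_le_sum hterm).trans ?_
      rw [← Finset.sum_mul]
      refine (mul_le_mul_of_nonneg_right htheta (by positivity)).trans (le_of_eq ?_)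
      have h4 : Real.log 4 = 2 * Real.log 2 := by
        rw [show (4:ℝ) = 2^2 by norm_num, Real.log_pow]; norm_num
      rw [h4]
      field_simp
      ring
    push_cast
    linarith

/-- Weak Mertens. -/
lemma sum_inv_primes_le (x : ℝ) (hx : Real.exp 1 ≤ x) :
    ∑ p ∈ (Finset.Icc 1 ⌊x⌋₊).filter Nat.Prime, (1:ℝ)/p ≤ 5 + 4 * Real.log (3 * Real.log x) := by
  have hx0 : 0 < x := lt_of_lt_of_le (Real.exp_pos 1) hx
  have hy : 1 ≤ Real.log x := by rwa [Real.le_log_iff_exp_le hx0]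
  set y := Real.log x with hydef
  have hl2 : 0.6931471803 < Real.log 2 := Real.log_two_gt_d9
  set K := ⌊3 * y⌋₊ with hK
  have hK1 : 3 * y < K + 1 := Nat.lt_floor_add_one _
  have hK2 : (K:ℝ) ≤ 3 * y := Nat.floor_le (by linarith)
  have hK0 : (1:ℝ) ≤ K := by
    have : 1 ≤ K := Nat.le_floor (by push_cast; linarith)
    exact_mod_cast this
  have hxle : x ≤ 2^(K+1) := by
    rw [← Real.log_le_log_iff hx0 (by positivity), Real.log_pow, ← hydef]
    push_cast
    nlinarith
  have hfl : ⌊x⌋₊ ≤ 2^(K+1) := by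
    have h1 := Nat.floor_le hx0.le
    have : (⌊x⌋₊ : ℝ) ≤ 2^(K+1) := h1.trans hxle
    exact_mod_cast this
  refine le_trans (Finset.sum_le_sum_of_subset_of_nonneg ?_ ?_)
    ((sum_inv_primes_dyadic K).trans ?_)
  · intro p
    simp only [Finset.mem_filter, Finset.mem_Icc]
    intro h
    exact ⟨⟨h.1.1, h.1.2.trans hfl⟩, h.2⟩
  · intro p _ _
    positivity
  · have h1 := harmonic_le_one_add_log K
    have h2 : Real.log K ≤ Real.log (3*y) := Real.log_le_log (by linarith) hK2
    linarith

lemma inv_le_exp (t : ℝ) (h0 : 0 ≤ t) (h1 : t ≤ 3/4) : (1 - t)⁻¹ ≤ Real.exp (4 * t) := by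
  have h2 : (1-t)⁻¹ ≤ 4 * t + 1 := by
    rw [inv_le_iff_one_le_mul₀ (by linarith)]
    nlinarith
  exact h2.trans (Real.add_one_le_exp _)

/-- power function as a monoid hom -/
noncomputable def powHom (c : ℝ) : ℕ →* ℝ where
  toFun n := (n:ℝ)^(-c)
  map_one' := by simp
  map_mul' a b := by
    push_cast
    exact Real.mul_rpow (by positivity) (by positivity)

lemma sum_divisors_le (n : ℕ) (c : ℝ) (hc : 1/2 ≤ c) :
    ∑ d ∈ n.divisors, (d:ℝ)^(-c) ≤ Real.exp (4 * ∑ q ∈ n.primeFactors, (q:ℝ)^(-c)) := by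
  obtain ⟨hs, hsum⟩ :=
    EulerProduct.summable_and_hasSum_factoredNumbers_prod_filter_prime_geometric
    (f := powHom c) (fun {p} hp => by
      have h1 := aux_lt_one p hp.two_le c hc
      have h0 : (0:ℝ) ≤ (p:ℝ)^(-c) := by positivity
      change ‖(p:ℝ)^(-c)‖ < 1
      rw [Real.norm_of_nonneg h0]
      linarith) n.primeFactors
  have hle : ∑ d ∈ n.divisors, (d:ℝ)^(-c) ≤
      ∏ p ∈ n.primeFactors with p.Prime, (1 - powHom c p)⁻¹ := by
    have hmem : ∀ d ∈ n.divisors, d ∈ Nat.factoredNumbers n.primeFactors := by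
      intro d hd
      rw [Nat.mem_factoredNumbers_iff_primeFactors_subset]
      have hd' := Nat.mem_divisors.mp hd
      exact ⟨fun h => by subst h; simp at hd', Nat.primeFactors_mono hd'.1 hd'.2⟩
    have := sum_le_hasSum (n.divisors.subtype (· ∈ Nat.factoredNumbers n.primeFactors))
      (fun i _ => (by change (0:ℝ) ≤ ((i:ℕ):ℝ)^(-c); positivity)) hsum
    refine le_trans (le_of_eq ?_) this
    rw [Finset.sum_subtype_of_mem (fun d => powHom c d) hmem]
    rfl
  refine hle.trans ?_
  rw [Finset.filter_true_of_mem (fun p hp => Nat.prime_of_mem_primeFactors hp),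
    Finset.mul_sum, Real.exp_sum]
  refine Finset.prod_le_prod ?_ ?_
  · intro p hp
    have h1 := aux_lt_one p (Nat.prime_of_mem_primeFactors hp).two_le c hc
    change 0 ≤ (1 - (p:ℝ)^(-c))⁻¹
    exact inv_nonneg.mpr (by linarith)
  · intro p hp
    exact inv_le_exp ((p:ℝ)^(-c)) (by positivity) (aux_lt_one p (Nat.prime_of_mem_primeFactors hp).two_le c hc)

lemma local_hasSum (p : ℕ) (hp : p.Prime) (c : ℝ) (hc : 1/2 ≤ c) :
    HasSum (fun k : ℕ => ((Nat.totient (p^k) : ℕ):ℝ)^(-c))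
      (1 + ((p-1 : ℕ):ℝ)^(-c) * (1 - (p:ℝ)^(-c))⁻¹) := by
  have h1 := aux_lt_one p hp.two_le c hc
  have h0 : (0:ℝ) ≤ (p:ℝ)^(-c) := by positivity
  have hg := (hasSum_geometric_of_lt_one h0 (by linarith)).mul_left (((p-1 : ℕ):ℝ)^(-c))
  have := hasSum_nat_add_iff (f := fun k : ℕ => ((Nat.totient (p^k) : ℕ):ℝ)^(-c)) 1
    (g := ((p-1 : ℕ):ℝ)^(-c) * (1 - (p:ℝ)^(-c))⁻¹)
  rw [add_comm]
  have h2 := this.mp ?_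
  · simpa using h2
  · refine (congrArg (fun f : ℕ → ℝ => HasSum f _) (funext fun k => ?_)).mpr hg
    rw [Nat.totient_prime_pow_succ hp]
    push_cast
    rw [Real.mul_rpow (by positivity) (by positivity), mul_comm, ← Real.rpow_natCast, ← Real.rpow_natCast,
      ← Real.rpow_mul (by positivity), ← Real.rpow_mul (by positivity), mul_comm (k:ℝ)]

lemma count_le (n : ℕ) (hn : 0 < n) (c : ℝ) (hc : 1/2 ≤ c) :
    (Set.ncard {m : ℕ | 0 < m ∧ Nat.totient m = n} : ℝ) ≤
      (n:ℝ)^c * Real.exp (4 * ∑ d ∈ n.divisors, (d:ℝ)^(-c)) := by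
  by_cases hfin : {m : ℕ | 0 < m ∧ Nat.totient m = n}.Finite
  swap
  · rw [Set.Infinite.ncard hfin]
    simp only [Nat.cast_zero]
    positivity
  rw [Set.ncard_eq_toFinset_card _ hfin]
  set T := hfin.toFinset with hT
  set S : Finset ℕ := n.divisors.image (· + 1) with hS
  obtain ⟨hs, hsum⟩ :=
    EulerProduct.summable_and_hasSum_factoredNumbers_prod_filter_prime_tsum
    (f := fun m : ℕ => ((Nat.totient m : ℕ):ℝ)^(-c)) (by simp)
    (fun {a b} hab => by
      rw [Nat.totient_mul hab]; push_cast
      exact Real.mul_rpow (by positivity) (by positivity))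
    (fun {p} hp => by
      refine (local_hasSum p hp c hc).summable.congr ?_
      intro k
      rw [Real.norm_of_nonneg (by positivity)]) S
  have hmem : ∀ m ∈ T, m ∈ Nat.factoredNumbers S := by
    intro m hm
    simp only [hT, Set.Finite.mem_toFinset, Set.mem_ofPred_eq] at hm
    rw [Nat.mem_factoredNumbers']
    intro p hp hpm
    rw [hS, Finset.mem_image]
    refine ⟨p - 1, ?_, Nat.sub_add_cancel hp.one_le⟩
    rw [Nat.mem_divisors]
    refine ⟨?_, hn.ne'⟩
    rw [← hm.2, ← Nat.totient_prime hp]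
    exact Nat.totient_dvd_of_dvd hpm
  have h1 : (T.card : ℝ) * (n:ℝ)^(-c) ≤
      ∏ p ∈ S with p.Prime, ∑' k : ℕ, ((Nat.totient (p^k) : ℕ):ℝ)^(-c) := by
    have := sum_le_hasSum (T.subtype (· ∈ Nat.factoredNumbers S))
      (fun i _ => (by positivity)) hsum
    refine le_trans (le_of_eq ?_) this
    rw [Finset.sum_subtype_of_mem (fun m : ℕ => ((Nat.totient m : ℕ):ℝ)^(-c)) hmem]
    rw [Finset.sum_congr rfl (g := fun _ => (n:ℝ)^(-c)), Finset.sum_const, nsmul_eq_mul]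
    intro m hm
    simp only [hT, Set.Finite.mem_toFinset, Set.mem_ofPred_eq] at hm
    rw [hm.2]
  have h2 : ∏ p ∈ S with p.Prime, ∑' k : ℕ, ((Nat.totient (p^k) : ℕ):ℝ)^(-c) ≤
      Real.exp (4 * ∑ d ∈ n.divisors, (d:ℝ)^(-c)) := by
    have h3 : ∏ p ∈ S with p.Prime, ∑' k : ℕ, ((Nat.totient (p^k) : ℕ):ℝ)^(-c) ≤
        ∏ p ∈ S with p.Prime, Real.exp (4 * ((p-1 : ℕ):ℝ)^(-c)) := by
      refine Finset.prod_le_prod (fun p _ => tsum_nonneg fun k => by positivity) ?_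
      intro p hp
      have hp' := (Finset.mem_filter.mp hp).2
      rw [(local_hasSum p hp' c hc).tsum_eq]
      refine le_trans ?_ (Real.add_one_le_exp _)
      have h4 := aux_lt_one p hp'.two_le c hc
      have h5 : (1 - (p:ℝ)^(-c))⁻¹ ≤ 4 := by
        rw [inv_le_iff_one_le_mul₀ (by linarith)]
        linarith
      have h6 : (0:ℝ) ≤ ((p-1 : ℕ):ℝ)^(-c) := by positivity
      nlinarith
    refine h3.trans ?_
    rw [← Real.exp_sum, Real.exp_le_exp, ← Finset.mul_sum]
    refine mul_le_mul_of_nonneg_left ?_ (by norm_num)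
    calc ∑ p ∈ S with p.Prime, ((p-1 : ℕ):ℝ)^(-c) ≤ ∑ p ∈ S, ((p-1 : ℕ):ℝ)^(-c) :=
          Finset.sum_le_sum_of_subset_of_nonneg (Finset.filter_subset _ _)
            (fun _ _ _ => by positivity)
      _ = ∑ d ∈ n.divisors, (d:ℝ)^(-c) := by
          rw [hS, Finset.sum_image (by intro a _ b _ h; simpa using h)]
          simp
  have hnc : (0:ℝ) < (n:ℝ)^c := by positivity
  calc (T.card : ℝ) = (n:ℝ)^c * (T.card * (n:ℝ)^(-c)) := by
        rw [Real.rpow_neg (by positivity)]; field_simp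
    _ ≤ _ := by gcongr; exact h1.trans h2

lemma card_primeFactors_le (n : ℕ) (hn : 0 < n) : (n.primeFactors.card : ℝ) ≤ 2 * Real.log n := by
  have h1 : 2 ^ n.primeFactors.card ≤ n := by
    calc 2 ^ n.primeFactors.card ≤ ∏ p ∈ n.primeFactors, p :=
          Finset.pow_card_le_prod _ _ _ (fun p hp => (Nat.prime_of_mem_primeFactors hp).two_le)
      _ ≤ n := Nat.le_of_dvd hn (Nat.prod_primeFactors_dvd n)
  have h2 : (2:ℝ) ^ n.primeFactors.card ≤ n := by exact_mod_cast h1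
  have h3 := Real.log_le_log (by positivity) h2
  rw [Real.log_pow] at h3
  have hl2 : 0.6931471803 < Real.log 2 := Real.log_two_gt_d9
  have : (0:ℝ) ≤ n.primeFactors.card := by positivity
  nlinarith

lemma sum_primeFactors_le (n : ℕ) (hn : 0 < n) (x δ : ℝ) (hx : x = Real.log n)
    (hxe : Real.exp 1 ≤ x) (hδ0 : 0 ≤ δ) (hδ : δ ≤ 1/2) :
    ∑ q ∈ n.primeFactors, (q:ℝ)^(-(1-δ)) ≤
      x^δ * (7 + 4 * Real.log (3 * Real.log x)) := by
  have hx0 : 0 < x := lt_of_lt_of_le (Real.exp_pos 1) hxe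
  rw [← Finset.sum_filter_add_sum_filter_not n.primeFactors (fun q : ℕ => (q:ℝ) ≤ x)]
  have hA : ∑ q ∈ n.primeFactors.filter (fun q : ℕ => (q:ℝ) ≤ x), (q:ℝ)^(-(1-δ)) ≤
      x^δ * (5 + 4 * Real.log (3 * Real.log x)) := by
    refine le_trans ?_ (mul_le_mul_of_nonneg_left (sum_inv_primes_le x hxe) (by positivity))
    rw [Finset.mul_sum]
    calc ∑ q ∈ n.primeFactors.filter (fun q : ℕ => (q:ℝ) ≤ x), (q:ℝ)^(-(1-δ)) ≤
        ∑ q ∈ n.primeFactors.filter (fun q : ℕ => (q:ℝ) ≤ x), x^δ * (1/(q:ℝ)) := by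
          refine Finset.sum_le_sum ?_
          intro q hq
          obtain ⟨hq1, hq2⟩ := Finset.mem_filter.mp hq
          have hq0 : (0:ℝ) < q := by exact_mod_cast (Nat.prime_of_mem_primeFactors hq1).pos
          rw [show -(1-δ) = δ - 1 by ring, Real.rpow_sub hq0, Real.rpow_one, mul_one_div]
          gcongr
      _ ≤ _ := by
          refine Finset.sum_le_sum_of_subset_of_nonneg ?_ (fun _ _ _ => by positivity)
          intro q hq
          obtain ⟨hq1, hq2⟩ := Finset.mem_filter.mp hq
          have hp := Nat.prime_of_mem_primeFactors hq1
          simp only [Finset.mem_filter, Finset.mem_Icc]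
          exact ⟨⟨hp.one_le, Nat.le_floor hq2⟩, hp⟩
  have hB : ∑ q ∈ n.primeFactors.filter (fun q : ℕ => ¬ (q:ℝ) ≤ x), (q:ℝ)^(-(1-δ)) ≤ x^δ * 2 := by
    calc ∑ q ∈ n.primeFactors.filter (fun q : ℕ => ¬ (q:ℝ) ≤ x), (q:ℝ)^(-(1-δ)) ≤
        ∑ q ∈ n.primeFactors.filter (fun q : ℕ => ¬ (q:ℝ) ≤ x), x^(-(1-δ)) := by
          refine Finset.sum_le_sum ?_
          intro q hq
          have hq2 := (Finset.mem_filter.mp hq).2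
          exact Real.rpow_le_rpow_of_nonpos hx0 (not_le.mp hq2).le (by linarith)
      _ ≤ ∑ q ∈ n.primeFactors, x^(-(1-δ)) :=
          Finset.sum_le_sum_of_subset_of_nonneg (Finset.filter_subset _ _)
            (fun _ _ _ => by positivity)
      _ = n.primeFactors.card * x^(-(1-δ)) := by rw [Finset.sum_const, nsmul_eq_mul]
      _ ≤ (2 * x) * x^(-(1-δ)) := by
          have := card_primeFactors_le n hn
          rw [← hx] at this
          gcongr
      _ = x^δ * 2 := by
          rw [show -(1-δ) = δ - 1 by ring, Real.rpow_sub hx0, Real.rpow_one]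
          field_simp
  linarith

open Filter Asymptotics in
lemma ev_y (a : ℝ) (ha : 0 < a) : ∀ᶠ y : ℝ in atTop,
    1 ≤ y ∧ 0 ≤ Real.log y ∧ Real.log y / y ≤ 1/2 ∧
    4 * (y^(1-a) * (7 + 4 * Real.log (3 * y))) ≤ y/2 ∧
    4 * Real.exp (y/2) ≤ a * (Real.exp y * Real.log y / y) := by
  have e1 : ∀ᶠ y : ℝ in atTop, Real.log y ≤ 1/2 * y := by
    filter_upwards [Real.isLittleO_log_id_atTop.bound (show (0:ℝ) < 1/2 by norm_num),
      eventually_ge_atTop 1] with y hy h1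
    simp only [id, Real.norm_eq_abs] at hy
    rw [abs_of_nonneg (by linarith : (0:ℝ) ≤ y)] at hy
    exact (le_abs_self _).trans hy
  have e2 : ∀ᶠ y : ℝ in atTop, Real.log y ≤ 1/256 * y^a := by
    filter_upwards [(isLittleO_log_rpow_atTop ha).bound (show (0:ℝ) < 1/256 by norm_num),
      eventually_ge_atTop 1] with y hy h1
    simp only [Real.norm_eq_abs] at hy
    rw [abs_of_nonneg (by positivity : (0:ℝ) ≤ y^a)] at hy
    exact (le_abs_self _).trans hy
  have e3 : ∀ᶠ y : ℝ in atTop, (7 + 4 * Real.log 3) * 16 ≤ y^a :=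
    (tendsto_rpow_atTop ha).eventually_ge_atTop _
  have e4 : ∀ᶠ y : ℝ in atTop, 4 / a ≤ Real.exp (y/2) / (y/2) ^ 1 * (1/2) := by
    have := (Real.tendsto_exp_div_pow_atTop 1).comp
      (tendsto_id.atTop_div_const (show (0:ℝ) < 2 by norm_num))
    have := (this.atTop_mul_const (show (0:ℝ) < 1/2 by norm_num)).eventually_ge_atTop (4/a)
    exact this
  filter_upwards [e1, e2, e3, e4, eventually_ge_atTop (Real.exp 1)] with y h1 h2 h3 h4 h5
  have hy0 : 0 < y := lt_of_lt_of_le (Real.exp_pos 1) h5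
  have hlog : 1 ≤ Real.log y := by rwa [Real.le_log_iff_exp_le hy0]
  have hy1 : 1 ≤ y := le_trans (by have := Real.add_one_le_exp (1:ℝ); linarith) h5
  refine ⟨hy1, by linarith, ?_, ?_, ?_⟩
  · rw [div_le_iff₀ hy0]; exact h1
  · rw [Real.log_mul (by norm_num) hy0.ne']
    have hb : 4 * (7 + 4 * (Real.log 3 + Real.log y)) ≤ 1/2 * y^a := by linarith
    have hm : y^(1-a) * y^a = y := by
      rw [← Real.rpow_add hy0]; simp
    have hp : 0 ≤ y^(1-a) := by positivity
    calc 4 * (y^(1-a) * (7 + 4 * (Real.log 3 + Real.log y)))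
        = y^(1-a) * (4 * (7 + 4 * (Real.log 3 + Real.log y))) := by ring
      _ ≤ y^(1-a) * (1/2 * y^a) := by gcongr
      _ = y/2 := by rw [← mul_left_comm, hm]; ring
  · have he : Real.exp y = Real.exp (y/2) * Real.exp (y/2) := by
      rw [← Real.exp_add]; ring_nf
    have h6 : 4 ≤ a * (Real.exp (y/2) / y) := by
      rw [div_le_iff₀ ha] at h4
      calc (4:ℝ) ≤ Real.exp (y/2) / (y/2) ^ 1 * (1/2) * a := h4
        _ = _ := by field_simp
    have h7 : 0 < Real.exp (y/2) := Real.exp_pos _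
    calc 4 * Real.exp (y/2) ≤ a * (Real.exp (y/2) / y) * Real.exp (y/2) := by gcongr
      _ = a * (Real.exp y / y) * 1 := by rw [he]; ring
      _ ≤ a * (Real.exp y / y) * Real.log y := by gcongr
      _ = _ := by ring

theorem totient_preimage_count :
    ∀ ε : ℝ, 0 < ε → ∃ N : ℕ, ∀ n : ℕ, N ≤ n →
      (Set.ncard {m : ℕ | 0 < m ∧ Nat.totient m = n} : ℝ) ≤
        (n : ℝ) / (L n) ^ ((1 : ℝ) - ε) := by
  intro ε hε
  obtain ⟨a, ha0, ha1, haε⟩ : ∃ a : ℝ, 0 < a ∧ a ≤ 1 ∧ 2 * a ≤ ε :=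
    ⟨min 1 (ε/2), by positivity, min_le_left _ _, by have := min_le_right 1 (ε/2); linarith⟩
  have hcast : Filter.Tendsto (fun n : ℕ => (n:ℝ)) Filter.atTop Filter.atTop :=
    tendsto_natCast_atTop_atTop
  have hlogx := Real.tendsto_log_atTop.comp hcast
  have hlogy := Real.tendsto_log_atTop.comp hlogx
  have hev := (hlogy.eventually (ev_y a ha0)).and
    ((hlogx.eventually_ge_atTop (Real.exp 1)).and (Filter.eventually_ge_atTop 1))
  obtain ⟨N, hN⟩ := Filter.eventually_atTop.mp hev
  refine ⟨N, fun n hn => ?_⟩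
  obtain ⟨⟨hy1, hz0, hzy, hQ, hfin⟩, hxe, hn1⟩ := hN n hn
  simp only [Function.comp] at hy1 hz0 hzy hQ hfin hxe
  unfold L
  set x := Real.log n with hx
  set y := Real.log x with hy
  set z := Real.log y with hz
  have hx0 : 0 < x := lt_of_lt_of_le (Real.exp_pos 1) hxe
  have hy0 : 0 < y := by linarith
  have hn0 : (0:ℝ) < n := by exact_mod_cast hn1
  have hexpy : Real.exp y = x := Real.exp_log hx0
  have hzy0 : 0 ≤ z / y := by positivity
  set δ := (1 - a) * (z / y) with hδ
  have hδ0 : 0 ≤ δ := mul_nonneg (by linarith) hzy0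
  have hδ1 : δ ≤ 1/2 := by nlinarith
  have hxδ : x ^ δ = y ^ (1 - a) := by
    rw [Real.rpow_def_of_pos hx0, Real.rpow_def_of_pos hy0, ← hy, ← hz, hδ]
    congr 1
    field_simp
  have hP := sum_primeFactors_le n hn1 x δ hx hxe hδ0 hδ1
  rw [hxδ, ← hy] at hP
  have hD := sum_divisors_le n (1 - δ) (by linarith)
  have hC := count_le n hn1 (1 - δ) (by linarith)
  have hD2 : ∑ d ∈ n.divisors, (d:ℝ)^(-(1-δ)) ≤ Real.exp (y/2) :=
    hD.trans (Real.exp_le_exp.mpr (by linarith))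
  rw [hexpy] at hfin
  refine hC.trans ?_
  rw [← Real.exp_mul, Real.rpow_def_of_pos hn0, ← hx, ← Real.exp_add]
  have hnx : (n:ℝ) = Real.exp x := (Real.exp_log hn0).symm
  rw [hnx, ← Real.exp_sub, Real.exp_le_exp]
  have hw : 0 ≤ x * z / y := by positivity
  have h1 : x * (1 - δ) = x - (1 - a) * (x * z / y) := by rw [hδ]; ring
  rw [h1]
  nlinarith
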